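/- arXiv:2410.07496 — 2 statements merged into one kernel-verified Lean document; each statement's English description precedes it below -/
import Mathlib

section
/- Let (g,·) be a perm algebra and r = Σᵢ uᵢ⊗vᵢ ∈ g⊗g a symmetric element (τ(r) = r). Then the following are equivalent: (i) r satisfies the classical perm Yang–Baxter equation P(r) = 0; (ii) (Δ_r ⊗ id)(r) = Σᵢⱼ uᵢ ⊗ uⱼ ⊗ vᵢ·vⱼ; (iii) (id ⊗ Δ_r)(r) = Σᵢⱼ uᵢ·uⱼ ⊗ vᵢ ⊗ vⱼ; where Δ_r(x) = Σᵢ (x·uᵢ ⊗ vᵢ + uᵢ ⊗ x·vᵢ − uᵢ ⊗ vᵢ·x). -/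
open TensorProduct

/-- A (right) perm product. -/
def IsPerm {g : Type*} (m : g → g → g) : Prop :=
  ∀ x y z, m (m x y) z = m x (m y z) ∧ m x (m y z) = m x (m z y)

/-- The linear map `Δ_r : x ↦ Σᵢ (x·uᵢ ⊗ vᵢ + uᵢ ⊗ x·vᵢ − uᵢ ⊗ vᵢ·x)`. -/
noncomputable def Dmap {K g : Type*} [Field K] [AddCommGroup g] [Module K g]
    {ι : Type*} [Fintype ι] (mul : g →ₗ[K] g →ₗ[K] g) (u v : ι → g) :
    g →ₗ[K] g ⊗[K] g :=
  ∑ i, (((TensorProduct.mk K g g).flip (v i)) ∘ₗ (mul.flip (u i))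
        + (TensorProduct.mk K g g (u i)) ∘ₗ (mul.flip (v i))
        - (TensorProduct.mk K g g (u i)) ∘ₗ (mul (v i)))

/-- A bilinear map takes the same value on the two legs of a symmetric tensor in either order. -/
theorem sum_bilin_comm_of_symm {K g W : Type*} [Field K] [AddCommGroup g] [Module K g]
    [AddCommGroup W] [Module K W] {ι : Type*} [Fintype ι] {u v : ι → g}
    (hsymm : ∑ i, v i ⊗ₜ[K] u i = ∑ i, u i ⊗ₜ[K] v i) (B : g →ₗ[K] g →ₗ[K] W) :
    ∑ i, B (v i) (u i) = ∑ i, B (u i) (v i) := by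
  simpa using congrArg (TensorProduct.lift B) hsymm

theorem Dmap_apply {K g : Type*} [Field K] [AddCommGroup g] [Module K g]
    {ι : Type*} [Fintype ι] (mul : g →ₗ[K] g →ₗ[K] g) (u v : ι → g) (x : g) :
    Dmap mul u v x =
      ∑ i, (mul x (u i) ⊗ₜ[K] v i + u i ⊗ₜ[K] mul x (v i) - u i ⊗ₜ[K] mul (v i) x) := by
  simp [Dmap]

/-- for a symmetric `r`, the classical perm Yang-Baxter equation
`P(r) = 0` is equivalent to `(Δ_r ⊗ id)(r) = Σᵢⱼ uᵢ ⊗ uⱼ ⊗ vᵢ·vⱼ` and to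
`(id ⊗ Δ_r)(r) = Σᵢⱼ uᵢ·uⱼ ⊗ vᵢ ⊗ vⱼ`. -/
theorem stmt16 {K g : Type*} [Field K] [AddCommGroup g] [Module K g]
    {ι : Type*} [Fintype ι]
    (mul : g →ₗ[K] g →ₗ[K] g) (hm : IsPerm (fun x y => mul x y))
    (u v : ι → g)
    (hsymm : ∑ i, v i ⊗ₜ[K] u i = ∑ i, u i ⊗ₜ[K] v i) :
    ((∑ i, ∑ j,
        (mul (u i) (u j) ⊗ₜ[K] (v j ⊗ₜ[K] v i)
          - u i ⊗ₜ[K] (u j ⊗ₜ[K] mul (v i) (v j))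
          + u j ⊗ₜ[K] (mul (u i) (v j) ⊗ₜ[K] v i)
          - u i ⊗ₜ[K] (mul (v i) (u j) ⊗ₜ[K] v j)) = (0 : g ⊗[K] (g ⊗[K] g))) ↔
      (TensorProduct.map (Dmap mul u v) LinearMap.id (∑ i, u i ⊗ₜ[K] v i)
        = ∑ i, ∑ j, (u i ⊗ₜ[K] u j) ⊗ₜ[K] mul (v i) (v j))) ∧
    ((∑ i, ∑ j,
        (mul (u i) (u j) ⊗ₜ[K] (v j ⊗ₜ[K] v i)
          - u i ⊗ₜ[K] (u j ⊗ₜ[K] mul (v i) (v j))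
          + u j ⊗ₜ[K] (mul (u i) (v j) ⊗ₜ[K] v i)
          - u i ⊗ₜ[K] (mul (v i) (u j) ⊗ₜ[K] v j)) = (0 : g ⊗[K] (g ⊗[K] g))) ↔
      (TensorProduct.map LinearMap.id (Dmap mul u v) (∑ i, u i ⊗ₜ[K] v i)
        = ∑ i, ∑ j, mul (u i) (u j) ⊗ₜ[K] (v i ⊗ₜ[K] v j))) := by
  constructor
  · rw [← (TensorProduct.assoc K g g g).injective.eq_iff,
      ← sub_eq_zero (a := TensorProduct.assoc K g g g _)]
    refine Eq.congr_left ?_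
    have h₃ : ∑ i, ∑ j, u i ⊗ₜ[K] (mul (v i) (u j) ⊗ₜ[K] v j)
        = ∑ i, ∑ j, u j ⊗ₜ[K] (mul (v j) (u i) ⊗ₜ[K] v i) := Finset.sum_comm
    simp only [map_sum, TensorProduct.map_tmul, Dmap_apply, LinearMap.id_apply,
      TensorProduct.sum_tmul, TensorProduct.add_tmul, TensorProduct.sub_tmul, map_add, map_sub,
      TensorProduct.assoc_tmul, Finset.sum_add_distrib, Finset.sum_sub_distrib, h₃]
    abel
  · rw [← (TensorProduct.congr (LinearEquiv.refl K g) (TensorProduct.comm K g g)).map_eq_zero_iff,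
      ← sub_eq_zero (a := TensorProduct.map _ _ _), ← neg_eq_zero (a := _ - _)]
    refine Eq.congr_left ?_
    have h₁ : ∑ i, ∑ j, u i ⊗ₜ[K] (mul (v i) (v j) ⊗ₜ[K] u j)
        = ∑ i, ∑ j, u i ⊗ₜ[K] (mul (v i) (u j) ⊗ₜ[K] v j) :=
      Finset.sum_congr rfl fun i _ => sum_bilin_comm_of_symm hsymm
        (((TensorProduct.mk K g g) ∘ₗ mul (v i)).compr₂ (TensorProduct.mk K g (g ⊗[K] g) (u i)))
    have h₂ : ∑ i, ∑ j, u i ⊗ₜ[K] (v j ⊗ₜ[K] mul (v i) (u j))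
        = ∑ i, ∑ j, u i ⊗ₜ[K] (u j ⊗ₜ[K] mul (v i) (v j)) :=
      Finset.sum_congr rfl fun i _ => sum_bilin_comm_of_symm hsymm
        (((TensorProduct.mk K g g).compl₂ (mul (v i))).compr₂
          (TensorProduct.mk K g (g ⊗[K] g) (u i)))
    have h₃ : ∑ i, ∑ j, u j ⊗ₜ[K] (v i ⊗ₜ[K] mul (u i) (v j))
        = ∑ i, ∑ j, u i ⊗ₜ[K] (u j ⊗ₜ[K] mul (v j) (v i)) := by
      rw [Finset.sum_comm]
      exact Finset.sum_congr rfl fun i _ => sum_bilin_comm_of_symm hsymm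
        (((TensorProduct.mk K g g).compl₂ (mul.flip (v i))).compr₂
          (TensorProduct.mk K g (g ⊗[K] g) (u i)))
    simp only [map_sum, TensorProduct.map_tmul, Dmap_apply, LinearMap.id_apply,
      TensorProduct.congr_tmul, LinearEquiv.refl_apply, TensorProduct.comm_tmul,
      TensorProduct.tmul_sum, TensorProduct.tmul_add, TensorProduct.tmul_sub, map_add, map_sub,
      Finset.sum_add_distrib, Finset.sum_sub_distrib, h₁, h₂, h₃]
    abel
end

section
/- Let (g,Δ) be a perm coalgebra and r = Σᵢ uᵢ⊗vᵢ ∈ g⊗g a symmetric element (τ(r) = r) satisfying the cosymplectic identity Σᵢ ((uᵢ)₍₁₎⊗(uᵢ)₍₂₎⊗vᵢ + (uᵢ)₍₁₎⊗vᵢ⊗(uᵢ)₍₂₎ − (uᵢ)₍₂₎⊗vᵢ⊗(uᵢ)₍₁₎ − vᵢ⊗(uᵢ)₍₂₎⊗(uᵢ)₍₁₎) = 0. Let ω be a symmetric bilinear form on g satisfying the classical co-perm Yang–Baxter equation in (g,Δ), and let ·_ω be the induced multiplication x ·_ω y = x₍₁₎ ω(x₍₂₎,y) + y₍₁₎ ω(x,y₍₂₎)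 − y₍₂₎ ω(x,y₍₁₎). Suppose r satisfies the classical perm Yang–Baxter equation P(r) = 0 computed with respect to the multiplication ·_ω. Then the linear map S : g → g defined by S(x) = Σᵢ uᵢ ω(vᵢ, x) is a Nijenhuis operator on the perm coalgebra (g,Δ), i.e. (S⊗S)Δ(x) + Δ(S²(x)) = (S⊗id)Δ(S(x)) + (id⊗S)Δ(S(x)) for all x ∈ g. -/
open TensorProduct

/-- A perm coalgebra. -/
def IsPermCoalg {K g : Type*} [Field K] [AddCommGroup g] [Module K g]
    (Δ : g →ₗ[K] g ⊗[K] g) : Prop :=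
  ∀ x : g,
    (TensorProduct.assoc K g g g) ((TensorProduct.map Δ LinearMap.id) (Δ x))
        = (TensorProduct.map LinearMap.id Δ) (Δ x) ∧
    (TensorProduct.map LinearMap.id Δ) (Δ x)
        = (TensorProduct.map LinearMap.id
            ((TensorProduct.comm K g g).toLinearMap ∘ₗ Δ)) (Δ x)

/-- Right contraction `a ⊗ b ↦ φ(b) • a`. -/
noncomputable def ctrR {K g : Type*} [Field K] [AddCommGroup g] [Module K g]
    (φ : g →ₗ[K] K) : g ⊗[K] g →ₗ[K] g :=
  (TensorProduct.rid K g).toLinearMap ∘ₗ TensorProduct.map LinearMap.id φ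

/-- Left contraction `a ⊗ b ↦ φ(a) • b`. -/
noncomputable def ctrL {K g : Type*} [Field K] [AddCommGroup g] [Module K g]
    (φ : g →ₗ[K] K) : g ⊗[K] g →ₗ[K] g :=
  (TensorProduct.lid K g).toLinearMap ∘ₗ TensorProduct.map φ LinearMap.id

/-- The pairing `a ⊗ b ↦ φ(a)·ψ(b)`. -/
noncomputable def dpair {K g : Type*} [Field K] [AddCommGroup g] [Module K g]
    (φ ψ : g →ₗ[K] K) : g ⊗[K] g →ₗ[K] K :=
  (TensorProduct.lid K K).toLinearMap ∘ₗ TensorProduct.map φ ψ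

/-- The multiplication `x ·_ω y = x₍₁₎ω(x₍₂₎,y) + y₍₁₎ω(x,y₍₂₎) − y₍₂₎ω(x,y₍₁₎)`. -/
noncomputable def mulOmega {K g : Type*} [Field K] [AddCommGroup g] [Module K g]
    (Δ : g →ₗ[K] g ⊗[K] g) (ω : g →ₗ[K] g →ₗ[K] K) (x y : g) : g :=
  ctrR (ω.flip y) (Δ x) + ctrR (ω x) (Δ y) - ctrL (ω x) (Δ y)

/-- The classical co-perm Yang-Baxter equation for `ω` with respect to `Δ`. -/
def CoYBE {K g : Type*} [Field K] [AddCommGroup g] [Module K g]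
    (Δ : g →ₗ[K] g ⊗[K] g) (ω : g →ₗ[K] g →ₗ[K] K) : Prop :=
  ∀ x y z : g,
    dpair (ω.flip z) (ω.flip y) (Δ x) - dpair (ω x) (ω y) (Δ z)
      + dpair (ω.flip z) (ω x) (Δ y) - dpair (ω x) (ω.flip z) (Δ y) = 0

section PermNijenhuis

variable {K g : Type*} [Field K] [AddCommGroup g] [Module K g]

@[simp]
theorem dpair_tmul (φ ψ : g →ₗ[K] K) (a b : g) : dpair φ ψ (a ⊗ₜ[K] b) = φ a * ψ b := by
  simp [dpair]

/-- Pairings of linear forms separate the points of `g ⊗ g`. -/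
theorem eq_of_dpair_eq {s t : g ⊗[K] g} (h : ∀ φ ψ : g →ₗ[K] K, dpair φ ψ s = dpair φ ψ t) :
    s = t := by
  let b := Module.Basis.ofVectorSpace K g
  refine (b.tensorProduct b).ext_elem fun ⟨i, j⟩ => ?_
  have key : (b.tensorProduct b).coord (i, j) = dpair (b.coord i) (b.coord j) := by
    ext x y
    simp [Module.Basis.tensorProduct_repr_tmul_apply, mul_comm]
  simpa [← key] using h (b.coord i) (b.coord j)

theorem dpair_map (φ ψ : g →ₗ[K] K) (f h : g →ₗ[K] g) (t : g ⊗[K] g) :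
    dpair φ ψ (TensorProduct.map f h t) = dpair (φ ∘ₗ f) (ψ ∘ₗ h) t := by
  induction t with
  | zero => simp
  | tmul a b => simp
  | add a b ha hb => simp only [map_add, ha, hb]

theorem apply_ctrR (α φ : g →ₗ[K] K) (t : g ⊗[K] g) : α (ctrR φ t) = dpair α φ t := by
  induction t with
  | zero => simp
  | tmul a b => simp [ctrR, mul_comm]
  | add a b ha hb => simp only [map_add, ha, hb]

theorem apply_ctrL (α φ : g →ₗ[K] K) (t : g ⊗[K] g) : α (ctrL φ t) = dpair φ α t := by
  induction t with
  | zero => simp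
  | tmul a b => simp [ctrL]
  | add a b ha hb => simp only [map_add, ha, hb]

/-- The pairing `a ⊗ (b ⊗ c) ↦ α(a)·β(b)·γ(c)`. -/
noncomputable def tripair (α β γ : g →ₗ[K] K) : g ⊗[K] (g ⊗[K] g) →ₗ[K] K :=
  (TensorProduct.lid K K).toLinearMap ∘ₗ TensorProduct.map α (dpair β γ)

theorem tripair_tmul (α β γ : g →ₗ[K] K) (a : g) (t : g ⊗[K] g) :
    tripair α β γ (a ⊗ₜ[K] t) = α a * dpair β γ t := by
  simp [tripair]

theorem dpair_comm (φ ψ : g →ₗ[K] K) (t : g ⊗[K] g) :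
    dpair φ ψ (TensorProduct.comm K g g t) = dpair ψ φ t := by
  induction t with
  | zero => simp
  | tmul a b => simp [mul_comm]
  | add a b ha hb => simp only [map_add, ha, hb]

theorem tripair_map_mk_flip (α β γ : g →ₗ[K] K) (c : g) (t : g ⊗[K] g) :
    tripair α β γ (TensorProduct.map LinearMap.id ((TensorProduct.mk K g g).flip c) t)
      = γ c * dpair α β t := by
  induction t with
  | zero => simp
  | tmul a b => simp [tripair_tmul]; ring
  | add a b ha hb => simp only [map_add, ha, hb, mul_add]

theorem tripair_map_mk (α β γ : g →ₗ[K] K) (c : g) (t : g ⊗[K] g) :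
    tripair α β γ (TensorProduct.map LinearMap.id (TensorProduct.mk K g g c) t)
      = β c * dpair α γ t := by
  induction t with
  | zero => simp
  | tmul a b => simp [tripair_tmul]; ring
  | add a b ha hb => simp only [map_add, ha, hb, mul_add]

/-- The map `g* → g`, `γ ↦ ∑ i, γ(v i) u i`, attached to `∑ i, u i ⊗ v i`. -/
def sharp {ι : Type*} [Fintype ι] (u v : ι → g) (γ : g →ₗ[K] K) : g := ∑ i, γ (v i) • u i

theorem apply_sharp {ι M : Type*} [Fintype ι] [AddCommGroup M] [Module K M] (u v : ι → g)
    (γ : g →ₗ[K] K) (f : g →ₗ[K] M) : f (sharp u v γ) = ∑ i, γ (v i) • f (u i) := by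
  simp [sharp]

theorem sharp_swap {ι : Type*} [Fintype ι] {u v : ι → g}
    (h : ∑ i, v i ⊗ₜ[K] u i = ∑ i, u i ⊗ₜ[K] v i) (γ : g →ₗ[K] K) :
    sharp v u γ = sharp u v γ := by
  simpa [ctrR, sharp] using congrArg (ctrR γ) h

/-- `mulOmega` evaluated against a linear form, as a bilinear form in its two arguments. -/
noncomputable def mulOmegaForm (Δ : g →ₗ[K] g ⊗[K] g) (ω : g →ₗ[K] g →ₗ[K] K)
    (α : g →ₗ[K] K) : g →ₗ[K] g →ₗ[K] K :=
  LinearMap.mk₂ K (fun x y => α (mulOmega Δ ω x y))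
    (fun x x' y => by
      simp only [mulOmega, ctrR, ctrL, map_add, map_sub, TensorProduct.map_add_right,
        TensorProduct.map_add_left, LinearMap.comp_add, LinearMap.add_apply]
      ring)
    (fun c x y => by
      simp only [mulOmega, ctrR, ctrL, map_add, map_sub, map_smul, TensorProduct.map_smul_right,
        TensorProduct.map_smul_left, LinearMap.comp_smul, LinearMap.smul_apply, smul_eq_mul]
      ring)
    (fun x y y' => by
      simp only [mulOmega, ctrR, ctrL, map_add, map_sub, TensorProduct.map_add_right,
        LinearMap.comp_add, LinearMap.add_apply]
      ring)
    (fun c x y => by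
      simp only [mulOmega, ctrR, ctrL, map_add, map_sub, map_smul, TensorProduct.map_smul_right,
        LinearMap.comp_smul, LinearMap.smul_apply, smul_eq_mul]
      ring)

theorem mulOmegaForm_apply (Δ : g →ₗ[K] g ⊗[K] g) (ω : g →ₗ[K] g →ₗ[K] K)
    (α : g →ₗ[K] K) (x y : g) : mulOmegaForm Δ ω α x y = α (mulOmega Δ ω x y) := rfl

theorem mulOmegaForm_eq_dpair (Δ : g →ₗ[K] g ⊗[K] g) {ω : g →ₗ[K] g →ₗ[K] K}
    (hω : ω.flip = ω) (α : g →ₗ[K] K) (x y : g) :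
    mulOmegaForm Δ ω α x y
      = dpair α (ω y) (Δ x) + dpair α (ω x) (Δ y) - dpair (ω x) α (Δ y) := by
  simp only [mulOmegaForm_apply, mulOmega, map_add, map_sub, apply_ctrR, apply_ctrL, hω]

theorem mulOmegaForm_sharp {ι : Type*} [Fintype ι] (Δ : g →ₗ[K] g ⊗[K] g)
    (ω : g →ₗ[K] g →ₗ[K] K) (α β γ : g →ₗ[K] K) (a b c d : ι → g) :
    mulOmegaForm Δ ω α (sharp a b β) (sharp c d γ)
      = ∑ i, ∑ j, β (b i) * γ (d j) * α (mulOmega Δ ω (a i) (c j)) := by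
  simp only [apply_sharp, LinearMap.sum_apply, LinearMap.smul_apply, smul_eq_mul,
    mulOmegaForm_apply, Finset.mul_sum, mul_assoc]

/-- The cosymplectic identity evaluated on three linear forms. -/
theorem dpair_sharp_of_cosymplectic {ι : Type*} [Fintype ι] {Δ : g →ₗ[K] g ⊗[K] g} {u v : ι → g}
    (h : ∑ i,
        (TensorProduct.map LinearMap.id ((TensorProduct.mk K g g).flip (v i)) (Δ (u i))
          + TensorProduct.map LinearMap.id (TensorProduct.mk K g g (v i)) (Δ (u i))
          - TensorProduct.map LinearMap.id (TensorProduct.mk K g g (v i))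
              ((TensorProduct.comm K g g) (Δ (u i)))
          - TensorProduct.mk K g (g ⊗[K] g) (v i)
              ((TensorProduct.comm K g g) (Δ (u i)))) = 0)
    (α β γ : g →ₗ[K] K) :
    dpair α β (Δ (sharp u v γ)) + dpair α γ (Δ (sharp u v β))
      - dpair γ α (Δ (sharp u v β)) - dpair γ β (Δ (sharp u v α)) = 0 := by
  have h' := congrArg (tripair α β γ) h
  simp only [map_sum, map_add, map_sub, map_zero, tripair_map_mk_flip, tripair_map_mk,
    TensorProduct.mk_apply, tripair_tmul, dpair_comm, Finset.sum_add_distrib,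
    Finset.sum_sub_distrib] at h'
  simpa only [apply_sharp, map_sum, map_smul, smul_eq_mul] using h'

/-- The classical perm Yang-Baxter equation for `·_ω` evaluated on three linear forms. -/
theorem mulOmegaForm_sharp_of_permYBE {ι : Type*} [Fintype ι] {Δ : g →ₗ[K] g ⊗[K] g}
    {ω : g →ₗ[K] g →ₗ[K] K} {u v : ι → g}
    (hsymm : ∑ i, v i ⊗ₜ[K] u i = ∑ i, u i ⊗ₜ[K] v i)
    (h : ∑ i, ∑ j,
        (mulOmega Δ ω (u i) (u j) ⊗ₜ[K] (v j ⊗ₜ[K] v i)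
          - u i ⊗ₜ[K] (u j ⊗ₜ[K] mulOmega Δ ω (v i) (v j))
          + u j ⊗ₜ[K] (mulOmega Δ ω (u i) (v j) ⊗ₜ[K] v i)
          - u i ⊗ₜ[K] (mulOmega Δ ω (v i) (u j) ⊗ₜ[K] v j)) = (0 : g ⊗[K] (g ⊗[K] g)))
    (α β γ : g →ₗ[K] K) :
    mulOmegaForm Δ ω α (sharp u v γ) (sharp u v β)
      - mulOmegaForm Δ ω γ (sharp u v α) (sharp u v β)
      + mulOmegaForm Δ ω β (sharp u v γ) (sharp u v α)
      - mulOmegaForm Δ ω β (sharp u v α) (sharp u v γ) = 0 := by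
  have h' := congrArg (tripair α β γ) h
  simp only [map_sum, map_add, map_sub, map_zero, tripair_tmul, dpair_tmul] at h'
  have e₂ : mulOmegaForm Δ ω γ (sharp u v α) (sharp u v β)
      = mulOmegaForm Δ ω γ (sharp v u α) (sharp v u β) := by
    simp only [sharp_swap hsymm]
  have e₃ : mulOmegaForm Δ ω β (sharp u v γ) (sharp u v α)
      = mulOmegaForm Δ ω β (sharp u v γ) (sharp v u α) := by
    simp only [sharp_swap hsymm]
  have e₄ : mulOmegaForm Δ ω β (sharp u v α) (sharp u v γ)
      = mulOmegaForm Δ ω β (sharp v u α) (sharp u v γ) := by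
    simp only [sharp_swap hsymm]
  rw [e₂, e₃, e₄]
  simp only [mulOmegaForm_sharp, ← Finset.sum_add_distrib, ← Finset.sum_sub_distrib]
  rw [← h']
  refine Finset.sum_congr rfl fun i _ => Finset.sum_congr rfl fun j _ => ?_
  ring

end PermNijenhuis

/-- with `(g,Δ)` a perm coalgebra, `r = Σᵢ uᵢ⊗vᵢ` symmetric and
cosymplectic, `ω` a symmetric solution of the classical co-perm Yang-Baxter
equation and `r` a solution of the classical perm Yang-Baxter equation for the
induced multiplication `·_ω`, the map `S(x) = Σᵢ uᵢ ω(vᵢ,x)` is a Nijenhuis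
operator on the perm coalgebra `(g,Δ)`. -/
theorem stmt19 {K g : Type*} [Field K] [AddCommGroup g] [Module K g]
    {ι : Type*} [Fintype ι]
    (Δ : g →ₗ[K] g ⊗[K] g) (hΔ : IsPermCoalg Δ)
    (u v : ι → g)
    (hsymm : ∑ i, v i ⊗ₜ[K] u i = ∑ i, u i ⊗ₜ[K] v i)
    (hcosymp : ∑ i,
        (TensorProduct.map LinearMap.id ((TensorProduct.mk K g g).flip (v i)) (Δ (u i))
          + TensorProduct.map LinearMap.id (TensorProduct.mk K g g (v i)) (Δ (u i))
          - TensorProduct.map LinearMap.id (TensorProduct.mk K g g (v i))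
              ((TensorProduct.comm K g g) (Δ (u i)))
          - TensorProduct.mk K g (g ⊗[K] g) (v i)
              ((TensorProduct.comm K g g) (Δ (u i)))) = 0)
    (ω : g →ₗ[K] g →ₗ[K] K) (hsym : ∀ x y : g, ω x y = ω y x)
    (hybe : CoYBE Δ ω)
    (hP : ∑ i, ∑ j,
        (mulOmega Δ ω (u i) (u j) ⊗ₜ[K] (v j ⊗ₜ[K] v i)
          - u i ⊗ₜ[K] (u j ⊗ₜ[K] mulOmega Δ ω (v i) (v j))
          + u j ⊗ₜ[K] (mulOmega Δ ω (u i) (v j) ⊗ₜ[K] v i)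
          - u i ⊗ₜ[K] (mulOmega Δ ω (v i) (u j) ⊗ₜ[K] v j)) = (0 : g ⊗[K] (g ⊗[K] g)))
    (S : g →ₗ[K] g)
    (hs : S = ∑ i, LinearMap.smulRight (ω (v i)) (u i)) :
    ∀ x : g,
      TensorProduct.map S S (Δ x) + Δ (S (S x))
        = TensorProduct.map S LinearMap.id (Δ (S x))
          + TensorProduct.map LinearMap.id S (Δ (S x)) := by
  intro x
  have hω : ω.flip = ω := by
    ext a b
    exact hsym b a
  have hSR : ∀ y, S y = sharp u v (ω y) := fun y => by
    simp [hs, sharp, hsym]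
  have hRS : ∀ φ : g →ₗ[K] K, φ ∘ₗ S = ω (sharp u v φ) := fun φ => by
    rw [← sharp_swap hsymm]
    ext y
    simp [hs, sharp, mul_comm]
  refine eq_of_dpair_eq fun φ ψ => ?_
  have hY := hybe (sharp u v φ) (sharp u v ψ) x
  have hC := dpair_sharp_of_cosymplectic hcosymp φ ψ (ω (sharp u v (ω x)))
  have hP' := mulOmegaForm_sharp_of_permYBE hsymm hP φ ψ (ω x)
  simp only [mulOmegaForm_eq_dpair Δ hω] at hP'
  rw [hω] at hY
  simp only [map_add, dpair_map, LinearMap.comp_id, hRS]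
  rw [hSR (S x), hSR x]
  linear_combination -hY + hC - hP'
end
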